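/- For every l ∈ ℒ_n and every m ∈ ℳ_n, the product β_n^m · β_n^l lies in the K-linear span of the set ℬ_n. -/

import Mathlib

/-- `uElt T i j` is the element `u_i^j`: the product `T_i T_{i-1} ⋯ T_{i-j+1}`
(interpreted as `1` when `j = 0`). -/
def uElt {A : Type*} [Monoid A] (T : ℕ → A) (i j : ℕ) : A :=
  ((List.range j).map fun t => T (i - t)).prod

/-- `betaElt T n l` is the element `β_n^l = u_1^{l_1} u_2^{l_2} ⋯ u_n^{l_n}`, where the
tuple `(l_1, …, l_n)` is encoded as `l : Fin n → ℕ` (so `l i` is `l_{i+1}`). -/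
def betaElt {A : Type*} [Monoid A] (T : ℕ → A) (n : ℕ) (l : Fin n → ℕ) : A :=
  (List.ofFn fun i : Fin n => uElt T (i.1 + 1) (l i)).prod

/-- The set `ℬ_n = {β_n^l : l ∈ ℒ_n}`, where `ℒ_n` is the set of tuples `(l_1, …, l_n)`
with `0 ≤ l_j ≤ j` for each `j`. -/
def heckeBasisSet {A : Type*} [Monoid A] (T : ℕ → A) (n : ℕ) : Set A :=
  {a : A | ∃ l : Fin n → ℕ, (∀ i : Fin n, l i ≤ i.1 + 1) ∧ a = betaElt T n l}

lemma uElt_succ' {A : Type*} [Monoid A] (T : ℕ → A) (i j : ℕ) :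
    uElt T i (j + 1) = uElt T i j * T (i - j) := by
  simp [uElt, List.range_succ]

lemma betaElt_succ' {A : Type*} [Monoid A] (T : ℕ → A) (n : ℕ) (l : Fin (n + 1) → ℕ) :
    betaElt T (n + 1) l =
      betaElt T n (fun i => l i.castSucc) * uElt T (n + 1) (l (Fin.last n)) := by
  unfold betaElt
  rw [List.ofFn_succ', List.concat_eq_append, List.prod_append, List.prod_singleton]
  rfl

lemma uElt_comm_low {A : Type*} [Monoid A] (n : ℕ) (T : ℕ → A)
    (hcomm : ∀ j k, 1 ≤ j → j ≤ n → 1 ≤ k → k ≤ n → 2 ≤ |(j : ℤ) - (k : ℤ)| →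
      T j * T k = T k * T j) (i : ℕ) (hi : i ≤ n) (k : ℕ) (hk : 1 ≤ k) (j : ℕ)
    (hkj : k + j < i) : uElt T i j * T k = T k * uElt T i j := by
  induction j with
  | zero => simp [uElt]
  | succ j ih =>
    rw [uElt_succ', mul_assoc, hcomm (i - j) k (by omega) (by omega) hk (by omega)
      (by rw [le_abs]; omega), ← mul_assoc, ih (by omega), mul_assoc]

lemma uElt_comm_high {A : Type*} [Monoid A] (n : ℕ) (T : ℕ → A)
    (hcomm : ∀ j k, 1 ≤ j → j ≤ n → 1 ≤ k → k ≤ n → 2 ≤ |(j : ℤ) - (k : ℤ)| →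
      T j * T k = T k * T j)
    (hbraid : ∀ j, 1 ≤ j → j + 1 ≤ n →
      T j * T (j + 1) * T j = T (j + 1) * T j * T (j + 1))
    (i : ℕ) (hi : i ≤ n) (k : ℕ) (hk : 1 ≤ k) (hki : k + 1 ≤ i) (j : ℕ) (hj : j ≤ i)
    (hkj : i < k + j) : uElt T i j * T (k + 1) = T k * uElt T i j := by
  induction j with
  | zero => omega
  | succ j ih =>
    by_cases h : i < k + j
    · rw [uElt_succ', mul_assoc, hcomm (i - j) (k + 1) (by omega) (by omega) (by omega) (by omega)
        (by rw [le_abs]; omega), ← mul_assoc, ih (by omega) h, mul_assoc]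
    · obtain ⟨j, rfl⟩ : ∃ j', j = j' + 1 := ⟨j - 1, by omega⟩
      have e1 : i - j = k + 1 := by omega
      have e2 : i - (j + 1) = k := by omega
      have h3 := hbraid k hk (by omega)
      have h4 := uElt_comm_low n T hcomm i hi k hk j (by omega)
      rw [uElt_succ', uElt_succ', e1, e2]
      calc uElt T i j * T (k + 1) * T k * T (k + 1)
          = uElt T i j * (T (k + 1) * T k * T (k + 1)) := by simp only [mul_assoc]
        _ = (uElt T i j * T k) * T (k + 1) * T k := by rw [← h3]; simp only [mul_assoc]
        _ = _ := by rw [h4]; simp only [mul_assoc]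

lemma span_mul_uElt {K : Type*} [Field K] {A : Type*} [Ring A] [Algebra K A] (m : ℕ) (T : ℕ → A)
    (x : A) (hx : x ∈ Submodule.span K (heckeBasisSet T m)) (j : ℕ) (hj : j ≤ m + 1) :
    x * uElt T (m + 1) j ∈ Submodule.span K (heckeBasisSet T (m + 1)) := by
  induction hx using Submodule.span_induction with
  | mem x h =>
    obtain ⟨l, hl, rfl⟩ := h
    refine Submodule.subset_span ⟨Fin.snoc l j, ?_, ?_⟩
    · intro i
      refine Fin.lastCases ?_ (fun i => ?_) i
      · simpa using hj
      · simpa using hl i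
    · rw [betaElt_succ']; simp
  | zero => simp
  | add x y _ _ hx hy => rw [add_mul]; exact add_mem hx hy
  | smul a x _ hx => rw [smul_mul_assoc]; exact Submodule.smul_mem _ _ hx

lemma span_mul_T {K : Type*} [Field K] (q : K)
    {A : Type*} [Ring A] [Algebra K A] (n : ℕ) (T : ℕ → A)
    (hcomm : ∀ j k, 1 ≤ j → j ≤ n → 1 ≤ k → k ≤ n → 2 ≤ |(j : ℤ) - (k : ℤ)| →
      T j * T k = T k * T j)
    (hbraid : ∀ j, 1 ≤ j → j + 1 ≤ n →
      T j * T (j + 1) * T j = T (j + 1) * T j * T (j + 1))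
    (hquad : ∀ j, 1 ≤ j → j ≤ n → T j ^ 2 = (q - 1) • T j + q • (1 : A))
    (m : ℕ) (hm : m ≤ n) : ∀ (k : ℕ), 1 ≤ k → k ≤ m → ∀ x : A,
      x ∈ Submodule.span K (heckeBasisSet T m) →
      x * T k ∈ Submodule.span K (heckeBasisSet T m) := by
  induction m with
  | zero => intro k h1 h2; omega
  | succ m ih =>
    intro k hk hkm x hx
    have ih := ih (by omega)
    induction hx using Submodule.span_induction with
    | zero => simp
    | add x y _ _ hx hy => rw [add_mul]; exact add_mem hx hy
    | smul a x _ hx => rw [smul_mul_assoc]; exact Submodule.smul_mem _ _ hx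
    | mem x h =>
      obtain ⟨l, hl, rfl⟩ := h
      rw [betaElt_succ']
      have hb : betaElt T m (fun i => l i.castSucc) ∈ Submodule.span K (heckeBasisSet T m) :=
        Submodule.subset_span ⟨_, fun i => by simpa using hl i.castSucc, rfl⟩
      have hj : l (Fin.last m) ≤ m + 1 := by simpa using hl (Fin.last m)
      generalize betaElt T m (fun i => l i.castSucc) = b at hb
      generalize l (Fin.last m) = j at hj
      rw [mul_assoc]
      rcases lt_trichotomy (k + j) (m + 1) with h | h | h
      · rw [uElt_comm_low n T hcomm (m + 1) hm k hk j h, ← mul_assoc]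
        exact span_mul_uElt m T _ (ih k hk (by omega) b hb) j hj
      · have e : uElt T (m + 1) j * T k = uElt T (m + 1) (j + 1) := by
          rw [uElt_succ']; congr 2; omega
        rw [e]
        exact span_mul_uElt m T _ hb _ (by omega)
      · by_cases h2 : k + j = m + 2
        · obtain ⟨j, rfl⟩ : ∃ j', j = j' + 1 := ⟨j - 1, by omega⟩
          have e : m + 1 - j = k := by omega
          have e2 : uElt T (m + 1) (j + 1) * T k
              = (q - 1) • uElt T (m + 1) (j + 1) + q • uElt T (m + 1) j := by
            rw [uElt_succ', e, mul_assoc, ← pow_two, hquad k hk (by omega), mul_add,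
              mul_smul_comm, mul_smul_comm, mul_one]
          rw [e2, mul_add, mul_smul_comm, mul_smul_comm]
          exact add_mem (Submodule.smul_mem _ _ (span_mul_uElt m T _ hb _ hj))
            (Submodule.smul_mem _ _ (span_mul_uElt m T _ hb _ (by omega)))
        · obtain ⟨k, rfl⟩ : ∃ k', k = k' + 1 := ⟨k - 1, by omega⟩
          rw [uElt_comm_high n T hcomm hbraid (m + 1) hm k (by omega) hkm j hj (by omega),
            ← mul_assoc]
          exact span_mul_uElt m T _ (ih k (by omega) (by omega) b hb) j hj

lemma mul_uElt_closed {A : Type*} [Monoid A] (n : ℕ) (T : ℕ → A) (S : Set A)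
    (hS : ∀ k, 1 ≤ k → k ≤ n → ∀ x ∈ S, x * T k ∈ S) (i : ℕ) (hi : i ≤ n) (j : ℕ) (hj : j ≤ i)
    (x : A) (hx : x ∈ S) : x * uElt T i j ∈ S := by
  induction j with
  | zero => simpa [uElt] using hx
  | succ j ih =>
    rw [uElt_succ', ← mul_assoc]
    exact hS _ (by omega) (by omega) _ (ih (by omega))

lemma mul_betaElt_closed {A : Type*} [Monoid A] (n : ℕ) (T : ℕ → A) (S : Set A)
    (hS : ∀ k, 1 ≤ k → k ≤ n → ∀ x ∈ S, x * T k ∈ S) (m : ℕ) (hm : m ≤ n)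
    (l : Fin m → ℕ) (hl : ∀ i : Fin m, l i ≤ i.1 + 1)
    (x : A) (hx : x ∈ S) : x * betaElt T m l ∈ S := by
  induction m with
  | zero => simpa [betaElt] using hx
  | succ m ih =>
    rw [betaElt_succ', ← mul_assoc]
    exact mul_uElt_closed n T S hS _ hm _ (by simpa using hl (Fin.last m)) _
      (ih (by omega) _ (fun i => by simpa using hl i.castSucc))

theorem betaM_mul_betaL_mem_span {K : Type*} [Field K] (q : K)
    {A : Type*} [Ring A] [Algebra K A] (n : ℕ) (T : ℕ → A)
    (hcomm : ∀ j k, 1 ≤ j → j ≤ n → 1 ≤ k → k ≤ n → 2 ≤ |(j : ℤ) - (k : ℤ)| →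
      T j * T k = T k * T j)
    (hbraid : ∀ j, 1 ≤ j → j + 1 ≤ n →
      T j * T (j + 1) * T j = T (j + 1) * T j * T (j + 1))
    (hquad : ∀ j, 1 ≤ j → j ≤ n → T j ^ 2 = (q - 1) • T j + q • (1 : A))
    (l : Fin n → ℕ) (hl : ∀ i : Fin n, l i ≤ i.1 + 1)
    (m : Fin n → ℕ) (hm : ∀ i : Fin n, m i ≤ 1) :
    betaElt T n m * betaElt T n l ∈ Submodule.span K (heckeBasisSet T n) := by
  exact mul_betaElt_closed n T (Submodule.span K (heckeBasisSet T n) : Set A)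
    (span_mul_T q n T hcomm hbraid hquad n le_rfl) n le_rfl l hl _
    (Submodule.subset_span ⟨m, fun i => (hm i).trans (by omega), rfl⟩)
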